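/- Let M_t, M_r be positive integers, M_* = min(M_t, M_r), M^* = max(M_t, M_r), and let d* : [0, ∞) → ℝ be the piecewise-linear function that interpolates the points (k, (M_t − k)(M_r − k)) for k = 0, 1, …, M_* and equals 0 for r ≥ M_*. Fix b > 0. Then the supremum, over all positive integers n and all nonnegative reals r_1, …, r_n (with partial sums r̄_0 = 0, r̄_k = r_1 + ⋯ + r_k), of min{ min_{0 ≤ k ≤ n−1} (d*(r̄_{k+1}) + b·r̄_k), b·r̄_n } equals Σ_{i=1}^{M_*} min{b, 2i − 1 + M^* − M_*}. -/

import Mathlib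

open Finset

/-- Corner values of the DMT curve: `d*(k) = (Mt - k)(Mr - k)`. -/
noncomputable def cornerVal (Mt Mr k : ℕ) : ℝ := ((Mt : ℝ) - k) * ((Mr : ℝ) - k)

/-- The piecewise-linear DMT curve `d* : [0,∞) → ℝ` interpolating the points
`(k, (Mt-k)(Mr-k))` for `k = 0,…,min Mt Mr`, and equal to `0` for `r ≥ min Mt Mr`. -/
noncomputable def dstar (Mt Mr : ℕ) (r : ℝ) : ℝ :=
  if (min Mt Mr : ℝ) ≤ r then 0
  else (1 - (r - ⌊r⌋₊)) * cornerVal Mt Mr ⌊r⌋₊ + (r - ⌊r⌋₊) * cornerVal Mt Mr (⌊r⌋₊ + 1)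

/-- The optimal distortion exponent `Δ(b) = ∑_{i=1}^{M_*} min {b, 2i-1+M^*-M_*}`. -/
noncomputable def Delta (Mt Mr : ℕ) (b : ℝ) : ℝ :=
  ∑ i ∈ Finset.Icc 1 (min Mt Mr),
    min b (2 * (i : ℝ) - 1 + (max Mt Mr : ℝ) - (min Mt Mr : ℝ))

/-- Bound the first `N` terms by the slopes, which sum to `N * (N + D)`, and the remaining ones
by `b`. -/
lemma sum_min_slope_le (D b : ℝ) (N M : ℕ) (h : N ≤ M) :
    ∑ i ∈ Finset.Icc 1 M, min b (2 * (i : ℝ) - 1 + D) ≤ N * (N + D) + b * (M - N) := by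
  induction M, h using Nat.le_induction with
  | base =>
    have key : ∀ K : ℕ, ∑ i ∈ Finset.Icc 1 K, min b (2 * (i : ℝ) - 1 + D) ≤ K * (K + D) := by
      intro K
      induction K with
      | zero => simp
      | succ K ih =>
        rw [Finset.sum_Icc_succ_top (by omega)]
        have := min_le_right b (2 * ((K + 1 : ℕ) : ℝ) - 1 + D)
        push_cast at *
        linarith
    have := key N
    linarith
  | succ M _ ih =>
    rw [Finset.sum_Icc_succ_top (by omega)]
    have := min_le_left b (2 * ((M + 1 : ℕ) : ℝ) - 1 + D)
    push_cast at *
    linarith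

lemma sum_min_slope_eq (D b : ℝ) (M : ℕ) (h : 2 * (M : ℝ) - 1 + D ≤ b) :
    ∑ i ∈ Finset.Icc 1 M, min b (2 * (i : ℝ) - 1 + D) = M * (M + D) := by
  induction M with
  | zero => simp
  | succ M ih =>
    rw [Finset.sum_Icc_succ_top (by omega), min_eq_right h, ih (by push_cast at h; linarith)]
    push_cast
    ring

lemma exists_le_sum_min_slope (D b : ℝ) (M : ℕ) :
    ∃ N ≤ M, N * (N + D) + b * (M - N) ≤
      ∑ i ∈ Finset.Icc 1 M, min b (2 * (i : ℝ) - 1 + D) := by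
  induction M with
  | zero => exact ⟨0, le_rfl, by simp⟩
  | succ M ih =>
    rcases le_total b (2 * ((M + 1 : ℕ) : ℝ) - 1 + D) with h | h
    · obtain ⟨N, hN, hle⟩ := ih
      refine ⟨N, by omega, ?_⟩
      rw [Finset.sum_Icc_succ_top (by omega), min_eq_left h]
      push_cast
      linarith
    · refine ⟨M + 1, le_rfl, ?_⟩
      rw [sum_min_slope_eq D b _ h]
      simp

lemma cornerVal_eq_min_max (Mt Mr k : ℕ) :
    cornerVal Mt Mr k = ((min Mt Mr : ℝ) - k) * ((max Mt Mr : ℝ) - k) := by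
  unfold cornerVal
  rcases le_total (Mt : ℝ) Mr with h | h
  · rw [min_eq_left h, max_eq_right h]
  · rw [min_eq_right h, max_eq_left h, mul_comm]

lemma Delta_eq_sum (Mt Mr : ℕ) (b : ℝ) :
    Delta Mt Mr b = ∑ i ∈ Finset.Icc 1 (min Mt Mr),
      min b (2 * (i : ℝ) - 1 + ((max Mt Mr : ℝ) - (min Mt Mr : ℝ))) := by
  simp only [Delta, add_sub_assoc]

lemma Delta_le_cornerVal_add (Mt Mr : ℕ) (b : ℝ) (k : ℕ) (hk : k ≤ min Mt Mr) :
    Delta Mt Mr b ≤ cornerVal Mt Mr k + b * k := by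
  rw [Delta_eq_sum, cornerVal_eq_min_max]
  refine (sum_min_slope_le _ b (min Mt Mr - k) _ (Nat.sub_le _ _)).trans (le_of_eq ?_)
  rw [Nat.cast_sub hk, Nat.cast_min]
  ring

lemma exists_cornerVal_add_le_Delta (Mt Mr : ℕ) (b : ℝ) :
    ∃ k ≤ min Mt Mr, cornerVal Mt Mr k + b * k ≤ Delta Mt Mr b := by
  obtain ⟨N, hN, hle⟩ := exists_le_sum_min_slope ((max Mt Mr : ℝ) - (min Mt Mr : ℝ)) b (min Mt Mr)
  refine ⟨min Mt Mr - N, Nat.sub_le _ _, ?_⟩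
  rw [Delta_eq_sum, cornerVal_eq_min_max]
  refine le_trans (le_of_eq ?_) hle
  rw [Nat.cast_sub hN, Nat.cast_min]
  ring

lemma cornerVal_antitone (Mt Mr : ℕ) {m k : ℕ} (hmk : m ≤ k) (hk : k ≤ min Mt Mr) :
    cornerVal Mt Mr k ≤ cornerVal Mt Mr m := by
  have hmk : (m : ℝ) ≤ k := by exact_mod_cast hmk
  have ht : (k : ℝ) ≤ Mt := by exact_mod_cast hk.trans (min_le_left _ _)
  have hr : (k : ℝ) ≤ Mr := by exact_mod_cast hk.trans (min_le_right _ _)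
  exact mul_le_mul (by linarith) (by linarith) (by linarith) (by linarith)

lemma cornerVal_nonneg (Mt Mr : ℕ) {k : ℕ} (hk : k ≤ min Mt Mr) : 0 ≤ cornerVal Mt Mr k := by
  have ht : (k : ℝ) ≤ Mt := by exact_mod_cast hk.trans (min_le_left _ _)
  have hr : (k : ℝ) ≤ Mr := by exact_mod_cast hk.trans (min_le_right _ _)
  exact mul_nonneg (by linarith) (by linarith)

lemma floor_add_one_le_min (Mt Mr : ℕ) {r : ℝ} (hr : 0 ≤ r) (h : ¬ (min Mt Mr : ℝ) ≤ r) :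
    ⌊r⌋₊ + 1 ≤ min Mt Mr := by
  rw [← Nat.cast_min] at h
  exact (Nat.floor_lt hr).2 (not_le.1 h)

lemma dstar_le_cornerVal (Mt Mr : ℕ) {m : ℕ} (hm : m ≤ min Mt Mr) {r : ℝ} (hr : (m : ℝ) ≤ r) :
    dstar Mt Mr r ≤ cornerVal Mt Mr m := by
  have hr0 : 0 ≤ r := (Nat.cast_nonneg m).trans hr
  unfold dstar
  split_ifs with h
  · exact cornerVal_nonneg Mt Mr hm
  · have hk := floor_add_one_le_min Mt Mr hr0 h
    have hmk : m ≤ ⌊r⌋₊ := Nat.le_floor hr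
    have h1 := cornerVal_antitone Mt Mr hmk (by omega)
    have h2 := cornerVal_antitone Mt Mr (hmk.trans (Nat.le_succ _)) hk
    have hlo := Nat.floor_le hr0
    have hhi := Nat.lt_floor_add_one r
    have e1 := mul_le_mul_of_nonneg_left h1 (by linarith : 0 ≤ 1 - (r - ⌊r⌋₊))
    have e2 := mul_le_mul_of_nonneg_left h2 (by linarith : 0 ≤ r - ⌊r⌋₊)
    simp only [Nat.succ_eq_add_one] at e2
    linarith

lemma Delta_le_dstar_add (Mt Mr : ℕ) {b : ℝ} (hb : 0 ≤ b) {r : ℝ} (hr : 0 ≤ r) :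
    Delta Mt Mr b ≤ dstar Mt Mr r + b * r := by
  unfold dstar
  split_ifs with h
  · have h1 := Delta_le_cornerVal_add Mt Mr b _ le_rfl
    rw [cornerVal_eq_min_max, Nat.cast_min, sub_self, zero_mul] at h1
    exact h1.trans (by gcongr)
  · have hk := floor_add_one_le_min Mt Mr hr h
    have h1 := Delta_le_cornerVal_add Mt Mr b ⌊r⌋₊ (by omega)
    have h2 := Delta_le_cornerVal_add Mt Mr b (⌊r⌋₊ + 1) hk
    push_cast at h2
    have hlo := Nat.floor_le hr
    have hhi := Nat.lt_floor_add_one r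
    have e1 := mul_le_mul_of_nonneg_left h1 (by linarith : 0 ≤ 1 - (r - ⌊r⌋₊))
    have e2 := mul_le_mul_of_nonneg_left h2 (by linarith : 0 ≤ r - ⌊r⌋₊)
    linarith

/-- Theorem 3 of the paper: the supremum over all numbers of layers `n ≥ 1` and all
nonnegative multiplexing gains `r_1,…,r_n` (here `r 0,…,r (n-1)`, partial sums
`r̄_k = ∑_{j<k} r j`) of the achieved exponent
`min { min_{0 ≤ k ≤ n-1} (d*(r̄_{k+1}) + b·r̄_k), b·r̄_n }` equals
`∑_{i=1}^{M_*} min {b, 2i-1+M^*-M_*}`. -/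
theorem stmt7 (Mt Mr : ℕ) (hMt : 0 < Mt) (hMr : 0 < Mr) (b : ℝ) (hb : 0 < b) :
    sSup { x : ℝ | ∃ (n : ℕ) (hn : 0 < n) (r : ℕ → ℝ), (∀ k, 0 ≤ r k) ∧
      x = min
        ((Finset.range n).inf' (Finset.nonempty_range_iff.mpr hn.ne')
          (fun k => dstar Mt Mr (∑ j ∈ Finset.range (k + 1), r j) +
            b * ∑ j ∈ Finset.range k, r j))
        (b * ∑ j ∈ Finset.range n, r j) } = Delta Mt Mr b := by
  apply csSup_eq_of_forall_le_of_forall_lt_exists_gt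
  · exact ⟨_, 1, one_pos, fun _ => 0, fun _ => le_rfl, rfl⟩
  · rintro x ⟨n, hn, r, hr, rfl⟩
    obtain ⟨m, hm, hle⟩ := exists_cornerVal_add_le_Delta Mt Mr b
    refine le_trans ?_ hle
    by_contra! hlt
    obtain ⟨hlayer, hlast⟩ := lt_min_iff.1 hlt
    rw [Finset.lt_inf'_iff] at hlayer
    have hsum : ∀ k ≤ n, ∑ j ∈ Finset.range k, r j ≤ m := by
      intro k
      induction k with
      | zero => simp
      | succ k ih =>
        intro hk
        by_contra! hgt
        have h1 := hlayer k (Finset.mem_range.2 hk)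
        have h2 := dstar_le_cornerVal Mt Mr hm hgt.le
        have h3 := mul_le_mul_of_nonneg_left (ih (by omega)) hb.le
        linarith
    have h1 := mul_le_mul_of_nonneg_left (hsum n le_rfl) hb.le
    have h2 := cornerVal_nonneg Mt Mr hm
    linarith
  · intro w hw
    obtain ⟨δ, hδ, hδw⟩ : ∃ δ : ℝ, 0 < δ ∧ b * δ < Delta Mt Mr b - w :=
      exists_pos_mul_lt (sub_pos.2 hw) b
    obtain ⟨n, hn⟩ := exists_nat_ge (Delta Mt Mr b / (b * δ))
    rw [div_le_iff₀ (mul_pos hb hδ)] at hn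
    refine ⟨_, ⟨n + 1, n.succ_pos, fun _ => δ, fun _ => hδ.le, rfl⟩, ?_⟩
    simp only [Finset.sum_const, Finset.card_range, nsmul_eq_mul]
    refine lt_min ((Finset.lt_inf'_iff _).2 fun k _ => ?_) ?_
    · have h := Delta_le_dstar_add Mt Mr hb.le (r := ((k + 1 : ℕ) : ℝ) * δ) (by positivity)
      push_cast at h ⊢
      linarith
    · have := mul_pos hb hδ
      push_cast
      linarith
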